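/- Let B_1, B_2 > 0 with B_1 ≠ B_2, j ∈ ℕ, and let s be complex with Re s > j+1. Then ∫_0^∞ r^{2j+1} (r^2+B_1)^{-s}(r^2+B_2)^{-s} dr = (√π Γ(2s-j-1) j! / (2^{2s} Γ(s) Γ(s+1/2))) · B_1^{-s} B_2^{j+1-s} (2B_1/(B_1+B_2))^{j+1} · F(((j+1)/2, (j+2)/2; s+1/2; ((B_1-B_2)/(B_1+B_2))^2), where F is the Gauss hypergeometric function. -/

import Mathlib

open MeasureTheory Complex

/-- The Pochhammer symbol (rising factorial) (a)_n = a(a+1)⋯(a+n-1) in ℂ. -/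
noncomputable def poch (a : ℂ) (n : ℕ) : ℂ := ∏ i ∈ Finset.range n, (a + i)

/-- The Gauss hypergeometric function ₂F₁(a,b;c;z) = Σ_n (a)_n (b)_n / (c)_n · z^n/n!. -/
noncomputable def hyp2F1 (a b c z : ℂ) : ℂ :=
  ∑' n : ℕ, poch a n * poch b n / (poch c n * (Nat.factorial n : ℂ)) * z ^ n


lemma poch_succ (a : ℂ) (n : ℕ) : poch a (n + 1) = poch a n * (a + n) := by
  simp [poch, Finset.prod_range_succ]

lemma poch_double (a : ℂ) (n : ℕ) :
    poch (2 * a) (2 * n) = 4 ^ n * (poch a n * poch (a + 1 / 2) n) := by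
  induction n with
  | zero => simp [poch]
  | succ n ih =>
    rw [show 2 * (n + 1) = 2 * n + 1 + 1 by ring, poch_succ, poch_succ, ih, poch_succ, poch_succ]
    push_cast
    ring

lemma Gamma_add_poch (a : ℂ) (ha : 0 < a.re) (n : ℕ) :
    Complex.Gamma (a + n) = poch a n * Complex.Gamma a := by
  induction n with
  | zero => simp [poch]
  | succ n ih =>
    have h : a + n ≠ 0 := by
      intro h
      have := congrArg Complex.re h
      simp at this
      have : (0 : ℝ) ≤ n := Nat.cast_nonneg n
      linarith
    rw [poch_succ, show a + ((n + 1 : ℕ) : ℂ) = (a + n) + 1 by push_cast; ring,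
      Complex.Gamma_add_one _ h, ih]
    ring

lemma poch_ne_zero (a : ℂ) (ha : 0 < a.re) (n : ℕ) : poch a n ≠ 0 := by
  rw [poch, Finset.prod_ne_zero_iff]
  intro i _ h
  have := congrArg Complex.re h
  simp at this
  have : (0 : ℝ) ≤ i := Nat.cast_nonneg i
  linarith

lemma choose_eq_poch (s : ℂ) (n : ℕ) :
    Ring.choose (s + n - 1) n = poch s n / (Nat.factorial n : ℂ) := by
  have h := Ring.factorial_nsmul_multichoose_eq_ascPochhammer s n
  rw [Ring.multichoose_eq, Polynomial.ascPochhammer_smeval_eq_eval, nsmul_eq_mul] at h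
  have h2 : ∀ n : ℕ, (ascPochhammer ℂ n).eval s = poch s n := by
    intro n
    induction n with
    | zero => simp [poch]
    | succ n ih => rw [ascPochhammer_succ_right, poch_succ]; simp [ih]
  rw [h2] at h
  have : (Nat.factorial n : ℂ) ≠ 0 := by exact_mod_cast Nat.factorial_ne_zero n
  field_simp
  rw [← h]; ring

lemma hasSum_binom (s : ℂ) (z : ℂ) (hz : ‖z‖ < 1) :
    HasSum (fun n : ℕ => poch s n / (Nat.factorial n : ℂ) * z ^ n) ((1 - z) ^ (-s)) := by
  have h := (Complex.one_div_one_sub_cpow_hasFPowerSeriesOnBall_zero s).hasSum (y := z) (by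
    simpa [enorm_eq_nnnorm, ← NNReal.coe_lt_coe] using hz)
  simp only [choose_eq_poch] at h
  simpa [FormalMultilinearSeries.ofScalars, Complex.cpow_neg, mul_comm] using h

lemma integral_series (j : ℕ) (s : ℂ) (hs : (j : ℝ) + 1 < s.re) (q : ℝ) (hq0 : 0 ≤ q) (hq : q < 1) :
    HasSum (fun n : ℕ => poch s n / (Nat.factorial n : ℂ) * (q : ℂ) ^ n *
        Complex.betaIntegral ((j + 2 * n : ℕ) + 1) (2 * s - j - 1))
      (∫ v in Set.Ioo (0 : ℝ) 1, (v : ℂ) ^ j * ((1 - v : ℝ) : ℂ) ^ (2 * s - j - 2) *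
        ((1 - q * v ^ 2 : ℝ) : ℂ) ^ (-s)) := by
  have hj : (0 : ℝ) ≤ j := Nat.cast_nonneg j
  have hre : 0 < (2 * s - j - 1).re := by simp; linarith
  let E : ℕ → ℝ → ℂ := fun k v => (v : ℂ) ^ (((k : ℕ) + 1 : ℂ) - 1) *
    (1 - (v : ℂ)) ^ ((2 * s - j - 1) - 1)
  have hE : ∀ k, IntegrableOn (E k) (Set.Ioo 0 1) := by
    intro k
    have := Complex.betaIntegral_convergent (u := (k : ℂ) + 1) (v := 2 * s - j - 1)
      (by simp; positivity) hre
    rwa [intervalIntegrable_iff_integrableOn_Ioo_of_le zero_le_one] at this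
  have hEv : ∀ k v, E k v = (v : ℂ) ^ k * (1 - (v : ℂ)) ^ (2 * s - j - 2) := by
    intro k v
    simp only [E]
    rw [add_sub_cancel_right, Complex.cpow_natCast]
    congr 2; ring
  have hbeta : ∀ k, Complex.betaIntegral ((k : ℕ) + 1) (2 * s - j - 1) =
      ∫ v in Set.Ioo (0 : ℝ) 1, E k v := by
    intro k
    rw [Complex.betaIntegral, intervalIntegral.integral_of_le zero_le_one,
      MeasureTheory.integral_Ioc_eq_integral_Ioo]
  simp only [hbeta, ← MeasureTheory.integral_const_mul]
  have hsum : Summable (fun n : ℕ => ‖poch s n / (Nat.factorial n : ℂ) * (q : ℂ) ^ n‖) := by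
    rw [summable_norm_iff]
    exact (hasSum_binom s q (by simpa [abs_of_nonneg hq0] using hq)).summable
  refine MeasureTheory.hasSum_integral_of_dominated_convergence
    (fun n v => ‖poch s n / (Nat.factorial n : ℂ) * (q : ℂ) ^ n‖ * ‖E j v‖) ?_ ?_ ?_ ?_ ?_
  · intro n
    exact ((hE _).const_mul _).aestronglyMeasurable
  · intro n
    refine MeasureTheory.ae_restrict_of_forall_mem measurableSet_Ioo (fun v hv => ?_)
    rw [norm_mul]
    gcongr
    rw [hEv, hEv, norm_mul, norm_mul]
    gcongr
    rw [norm_pow, norm_pow]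
    refine pow_le_pow_of_le_one (norm_nonneg _) ?_ (by omega)
    rw [Complex.norm_real, Real.norm_of_nonneg hv.1.le]
    exact hv.2.le
  · exact Filter.Eventually.of_forall fun v => hsum.mul_right _
  · simp only [tsum_mul_right]
    exact (hE j).norm.const_mul _
  · refine MeasureTheory.ae_restrict_of_forall_mem measurableSet_Ioo (fun v hv => ?_)
    have hqv : q * v ^ 2 < 1 := by
      have : v ^ 2 ≤ 1 := by have := hv.1; have := hv.2; nlinarith
      nlinarith [sq_nonneg v]
    have h := hasSum_binom s ((q * v ^ 2 : ℝ) : ℂ) (by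
      rw [Complex.norm_real, Real.norm_of_nonneg (by positivity)]; exact hqv)
    have h2 := h.mul_left (E j v)
    have hval : (v : ℂ) ^ j * ((1 - v : ℝ) : ℂ) ^ (2 * s - j - 2) *
        ((1 - q * v ^ 2 : ℝ) : ℂ) ^ (-s) = E j v * (1 - ((q * v ^ 2 : ℝ) : ℂ)) ^ (-s) := by
      rw [hEv]; push_cast; ring
    rw [hval]
    have hfun : (fun n : ℕ => poch s n / (Nat.factorial n : ℂ) * (q : ℂ) ^ n * E (j + 2 * n) v) =
        fun n : ℕ => E j v *
          (poch s n / (Nat.factorial n : ℂ) * ((q * v ^ 2 : ℝ) : ℂ) ^ n) := by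
      funext n
      rw [hEv, hEv]; push_cast; ring
    rw [hfun]
    exact h2

lemma integral_subst (B₁ B₂ : ℝ) (hB₁ : 0 < B₁) (hB₂ : 0 < B₂) (j : ℕ) (s : ℂ) (m q : ℝ)
    (hm : m = (B₁ + B₂) / (2 * (B₁ * B₂))) (hq : q = ((B₁ - B₂) / (B₁ + B₂)) ^ 2) :
    (∫ r in Set.Ioi (0 : ℝ),
        (r : ℂ) ^ (2 * j + 1) * ((r ^ 2 + B₁ : ℝ) : ℂ) ^ (-s) *
          ((r ^ 2 + B₂ : ℝ) : ℂ) ^ (-s)) =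
     ∫ v in Set.Ioo (0 : ℝ) 1, ((B₁ * B₂ : ℝ) : ℂ) ^ (-s) / (2 * (m : ℂ) ^ (j + 1)) *
       ((v : ℂ) ^ j * ((1 - v : ℝ) : ℂ) ^ (2 * s - j - 2) * ((1 - q * v ^ 2 : ℝ) : ℂ) ^ (-s)) := by
  have hm0 : 0 < m := by rw [hm]; positivity
  have hq1 : q < 1 := by
    rw [hq, div_pow, div_lt_one (by positivity)]; nlinarith [mul_pos hB₁ hB₂]
  have himg : (fun r : ℝ => m * r ^ 2 / (1 + m * r ^ 2)) '' Set.Ioi 0 = Set.Ioo 0 1 := by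
    ext v
    constructor
    · rintro ⟨r, hr, rfl⟩
      have hr : 0 < r := hr
      refine ⟨by positivity, ?_⟩
      simp only
      rw [div_lt_one (by positivity)]; linarith
    · rintro ⟨h0, h1⟩
      have h1' : 0 < 1 - v := by linarith
      refine ⟨Real.sqrt (v / (m * (1 - v))), Real.sqrt_pos.mpr (by positivity), ?_⟩
      simp only
      rw [Real.sq_sqrt (by positivity)]
      field_simp
      ring
  rw [← himg, integral_image_eq_integral_abs_deriv_smul (f' := fun r => 2 * m * r / (1 + m * r ^ 2) ^ 2)
    measurableSet_Ioi]
  · refine MeasureTheory.setIntegral_congr_fun measurableSet_Ioi (fun r hr => ?_)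
    have hr : 0 < r := hr
    have hw : 0 < 1 + m * r ^ 2 := by positivity
    beta_reduce
    have e1 : (1 : ℝ) - m * r ^ 2 / (1 + m * r ^ 2) = (1 + m * r ^ 2)⁻¹ := by field_simp; ring
    set w := 1 + m * r ^ 2 with hwdef
    set u := 1 - q * (m * r ^ 2 / w) ^ 2 with hu
    have hu0 : 0 < u := by
      have h1 : 0 < m * r ^ 2 / w := by positivity
      have h2 : m * r ^ 2 / w < 1 := by rw [div_lt_one hw]; linarith
      have : (m * r ^ 2 / w) ^ 2 ≤ 1 := by nlinarith
      have : q ≥ 0 := by rw [hq]; positivity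
      rw [hu]; nlinarith [sq_nonneg (m * r ^ 2 / w)]
    have key : (r ^ 2 + B₁) * (r ^ 2 + B₂) = (B₁ * B₂) * (w ^ 2 * u) := by
      rw [hu, mul_sub, mul_one, div_pow]
      have : w ^ 2 * (q * ((m * r ^ 2) ^ 2 / w ^ 2)) = q * (m * r ^ 2) ^ 2 := by field_simp
      rw [this, hwdef, hq, hm]
      field_simp
      ring
    have hww : ((w ^ 2 : ℝ) : ℂ) ^ (-s) = (w : ℂ) ^ (-(2 * s)) := by
      rw [pow_two, Complex.ofReal_mul, Complex.mul_cpow_ofReal_nonneg hw.le hw.le,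
        ← Complex.cpow_add _ _ (by exact_mod_cast hw.ne')]
      congr 1; ring
    have keyC : ((r ^ 2 + B₁ : ℝ) : ℂ) ^ (-s) * ((r ^ 2 + B₂ : ℝ) : ℂ) ^ (-s) =
        ((B₁ * B₂ : ℝ) : ℂ) ^ (-s) * (((w : ℝ) : ℂ) ^ (-(2 * s)) * ((u : ℝ) : ℂ) ^ (-s)) := by
      rw [← Complex.mul_cpow_ofReal_nonneg (by positivity) (by positivity), ← Complex.ofReal_mul,
        key, Complex.ofReal_mul (B₁ * B₂),
        Complex.mul_cpow_ofReal_nonneg (by positivity) (by positivity),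
        Complex.ofReal_mul (w ^ 2), Complex.mul_cpow_ofReal_nonneg (by positivity) hu0.le, hww]
    have hwC : (w : ℂ) ≠ 0 := by exact_mod_cast hw.ne'
    have hmC : (m : ℂ) ≠ 0 := by exact_mod_cast hm0.ne'
    rw [mul_assoc, keyC, e1, abs_of_pos (by positivity), Complex.real_smul]
    have e2 : ((w⁻¹ : ℝ) : ℂ) ^ (2 * s - j - 2) = (w : ℂ) ^ (-(2 * s)) * (w : ℂ) ^ (j + 2) := by
      rw [Complex.ofReal_inv, Complex.inv_cpow _ _ (by
        rw [Complex.arg_ofReal_of_nonneg hw.le]; exact Real.pi_pos.ne), ← Complex.cpow_neg,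
        ← Complex.cpow_natCast, ← Complex.cpow_add _ _ hwC]
      congr 1; push_cast; ring
    rw [e2]
    push_cast
    rw [div_pow, mul_pow]
    field_simp
    ring
  · intro r hr
    have hr : 0 < r := hr
    have hw : 1 + m * r ^ 2 ≠ 0 := by positivity
    have h1 : HasDerivAt (fun r : ℝ => m * r ^ 2) (m * (2 * r)) r := by
      simpa using (hasDerivAt_pow 2 r).const_mul m
    have := h1.div (h1.const_add 1) hw
    have h3 : 2 * m * r / (1 + m * r ^ 2) ^ 2 =
        (m * (2 * r) * (1 + m * r ^ 2) - m * r ^ 2 * (m * (2 * r))) / (1 + m * r ^ 2) ^ 2 := by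
      congr 1; ring
    rw [h3]
    exact this.hasDerivWithinAt
  · intro a ha b hb hab
    have ha : 0 < a := ha
    have hb : 0 < b := hb
    simp only at hab
    rw [div_eq_div_iff (by positivity) (by positivity)] at hab
    have : m * a ^ 2 = m * b ^ 2 := by linarith
    have := mul_left_cancel₀ hm0.ne' this
    exact (pow_left_inj₀ ha.le hb.le two_ne_zero).mp this

/-- Formula (B.5): for B₁, B₂ > 0, B₁ ≠ B₂, j ∈ ℕ and s ∈ ℂ with Re s > j+1,
∫_0^∞ r^{2j+1} (r²+B₁)^{-s}(r²+B₂)^{-s} dr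
  = (√π Γ(2s-j-1) j!)/(2^{2s} Γ(s) Γ(s+1/2)) · B₁^{-s} B₂^{j+1-s} (2B₁/(B₁+B₂))^{j+1}
      · ₂F₁((j+1)/2, (j+2)/2; s+1/2; ((B₁-B₂)/(B₁+B₂))²). -/
theorem integral_eq_hypergeometric (B₁ B₂ : ℝ) (hB₁ : 0 < B₁) (hB₂ : 0 < B₂)
    (hne : B₁ ≠ B₂) (j : ℕ) (s : ℂ) (hs : (j : ℝ) + 1 < s.re) :
    (∫ r in Set.Ioi (0 : ℝ),
        (r : ℂ) ^ (2 * j + 1) * ((r ^ 2 + B₁ : ℝ) : ℂ) ^ (-s) *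
          ((r ^ 2 + B₂ : ℝ) : ℂ) ^ (-s)) =
      (Real.sqrt Real.pi : ℂ) * Complex.Gamma (2 * s - j - 1) * (Nat.factorial j : ℂ) /
          ((2 : ℂ) ^ (2 * s) * Complex.Gamma s * Complex.Gamma (s + 1 / 2)) *
        ((B₁ : ℂ) ^ (-s) * ((B₂ : ℝ) : ℂ) ^ ((j : ℂ) + 1 - s) *
          ((2 * B₁ / (B₁ + B₂) : ℝ) : ℂ) ^ (j + 1)) *
        hyp2F1 (((j : ℂ) + 1) / 2) (((j : ℂ) + 2) / 2) (s + 1 / 2)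
          ((((B₁ - B₂) / (B₁ + B₂) : ℝ) : ℂ) ^ 2) := by
  have hj : (0 : ℝ) ≤ j := Nat.cast_nonneg j
  have hs0 : 0 < s.re := by linarith
  have hre : 0 < (2 * s - j - 1).re := by simp; linarith
  have hq1 : ((B₁ - B₂) / (B₁ + B₂)) ^ 2 < 1 := by
    rw [div_pow, div_lt_one (by positivity)]; nlinarith [mul_pos hB₁ hB₂]
  rw [integral_subst B₁ B₂ hB₁ hB₂ j s _ _ rfl rfl, MeasureTheory.integral_const_mul,
    ← (integral_series j s hs _ (sq_nonneg _) hq1).tsum_eq, hyp2F1, ← tsum_mul_left,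
    ← tsum_mul_left]
  refine tsum_congr fun n => ?_
  have hb1 : (B₁ : ℂ) ≠ 0 := by exact_mod_cast hB₁.ne'
  have hb2 : (B₂ : ℂ) ≠ 0 := by exact_mod_cast hB₂.ne'
  have hb12 : (B₁ : ℂ) + B₂ ≠ 0 := by exact_mod_cast (add_pos hB₁ hB₂).ne'
  have hG2 : Complex.Gamma (2 * s) ≠ 0 := Complex.Gamma_ne_zero_of_re_pos (by simpa using hs0)
  have hGs : Complex.Gamma s ≠ 0 := Complex.Gamma_ne_zero_of_re_pos hs0
  have hGs2 : Complex.Gamma (s + 1 / 2) ≠ 0 :=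
    Complex.Gamma_ne_zero_of_re_pos (by simp; linarith)
  have hp1 := poch_ne_zero s hs0 n
  have hp2 := poch_ne_zero (s + 1 / 2) (by simp; linarith) n
  have hf : (Nat.factorial n : ℂ) ≠ 0 := by exact_mod_cast Nat.factorial_ne_zero n
  have h2 : (2 : ℂ) ^ (2 * s) ≠ 0 := by simp [Complex.cpow_eq_zero_iff]
  -- the Beta integral
  have hB : Complex.betaIntegral ((j + 2 * n : ℕ) + 1) (2 * s - j - 1) =
      (4 ^ n * (poch (((j : ℂ) + 1) / 2) n * poch (((j : ℂ) + 2) / 2) n) *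
        (Nat.factorial j : ℂ)) * Complex.Gamma (2 * s - j - 1) /
      (4 ^ n * (poch s n * poch (s + 1 / 2) n) * Complex.Gamma (2 * s)) := by
    rw [Complex.betaIntegral_eq_Gamma_mul_div _ _ (by simp; positivity) hre]
    have e1 : (((j + 2 * n : ℕ) : ℂ) + 1) = ((j : ℂ) + 1) + ((2 * n : ℕ) : ℂ) := by
      push_cast; ring
    have e2 : (((j + 2 * n : ℕ) : ℂ) + 1) + (2 * s - j - 1) = 2 * s + ((2 * n : ℕ) : ℂ) := by
      push_cast; ring
    rw [e2, e1, Gamma_add_poch _ (by simp; positivity), Gamma_add_poch _ (by simpa using hs0),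
      poch_double, show (j : ℂ) + 1 = 2 * (((j : ℂ) + 1) / 2) by ring, poch_double,
      show 2 * (((j : ℂ) + 1) / 2) = (j : ℂ) + 1 by ring, Complex.Gamma_nat_eq_factorial,
      show ((j : ℂ) + 1) / 2 + 1 / 2 = ((j : ℂ) + 2) / 2 by ring]
  have hdup := Complex.Gamma_mul_Gamma_add_half s
  rw [Complex.cpow_sub _ _ two_ne_zero, Complex.cpow_one] at hdup
  have hpi : (Real.sqrt Real.pi : ℂ) ≠ 0 := by
    exact_mod_cast (Real.sqrt_pos.mpr Real.pi_pos).ne'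
  have hc : (Real.sqrt Real.pi : ℂ) * Complex.Gamma (2 * s - j - 1) * (Nat.factorial j : ℂ) /
          ((2 : ℂ) ^ (2 * s) * Complex.Gamma s * Complex.Gamma (s + 1 / 2)) =
      Complex.Gamma (2 * s - j - 1) * (Nat.factorial j : ℂ) / (2 * Complex.Gamma (2 * s)) := by
    rw [mul_assoc ((2 : ℂ) ^ (2 * s)), hdup]
    field_simp
  have hB2 : ((B₂ : ℝ) : ℂ) ^ ((j : ℂ) + 1 - s) = (B₂ : ℂ) ^ (j + 1) * (B₂ : ℂ) ^ (-s) := by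
    rw [← Complex.cpow_natCast, ← Complex.cpow_add _ _ hb2]
    congr 1; push_cast; ring
  have hfour : (4 : ℂ) ^ n ≠ 0 := pow_ne_zero _ (by norm_num)
  rw [hB, hc, hB2, Complex.ofReal_mul, Complex.mul_cpow_ofReal_nonneg hB₁.le hB₂.le]
  clear hB hc hB2 hdup
  generalize (B₁ : ℂ) ^ (-s) = X1
  generalize (B₂ : ℂ) ^ (-s) = X2
  generalize Complex.Gamma (2 * s - j - 1) = G1
  generalize Complex.Gamma (2 * s) = G2 at *
  generalize poch s n = p1 at *
  generalize poch (s + 1 / 2) n = p2 at *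
  generalize poch (((j : ℂ) + 1) / 2) n = p3
  generalize poch (((j : ℂ) + 2) / 2) n = p4
  generalize (Nat.factorial n : ℂ) = f at *
  generalize (Nat.factorial j : ℂ) = g
  generalize (4 : ℂ) ^ n = F at *
  rw [Complex.ofReal_pow ((B₁ - B₂) / (B₁ + B₂)) 2]
  generalize ((((B₁ - B₂) / (B₁ + B₂) : ℝ) : ℂ) ^ 2) ^ n = Q
  have hM : (1 : ℂ) / (((B₁ + B₂) / (2 * (B₁ * B₂)) : ℝ) : ℂ) ^ (j + 1) =
      (B₂ : ℂ) ^ (j + 1) * ((2 * B₁ / (B₁ + B₂) : ℝ) : ℂ) ^ (j + 1) := by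
    rw [← mul_pow, one_div, ← inv_pow]
    congr 1
    push_cast
    field_simp
  generalize (((B₁ + B₂) / (2 * (B₁ * B₂)) : ℝ) : ℂ) ^ (j + 1) = M at *
  calc _ = X1 * X2 * (1 / M) * Q * g * p3 * p4 * G1 / (2 * G2 * f * p2) := by
        field_simp
    _ = _ := by
        rw [hM]
        field_simp
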